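/- arXiv:2407.03574 — 3 statements merged into one kernel-verified Lean document; each statement's English description precedes it below -/
import Mathlib

section
/- Let f : Ω → [0, ∞) and let 𝒞 be a closed cluster tree for f with height h = h_f. Then the supremum defining the merge height is attained: for any x, y ∈ Ω with m_𝒞(x, y) > 0, there exists C ∈ 𝒞 containing both x and y such that h(C) = m_𝒞(x, y). -/
open Set Topology ENNReal

/-- `C` is a connected component of the set `s` (a maximal connected subset). -/
def IsConnCompOf {Ω : Type*} [TopologicalSpace Ω] (s C : Set Ω) : Prop :=
  ∃ x ∈ s, C = connectedComponentIn s x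

/-- The Hartigan cluster tree of `f`: the collection of all connected components of the
upper level sets `{x | f x ≥ lam}` over all `lam > 0`. -/
def HartiganTree {Ω : Type*} [TopologicalSpace Ω] (f : Ω → ℝ) : Set (Set Ω) :=
  {C | ∃ lam > (0 : ℝ), IsConnCompOf {y | lam ≤ f y} C}

/-- The natural height function `h_f(C) = inf_{x ∈ C} f x`. -/
noncomputable def heightFn {Ω : Type*} (f : Ω → ℝ) (C : Set Ω) : ℝ := sInf (f '' C)

/-- The merge height of `x` and `y` in the dendrogram `(T, h)`:
`m_{(T,h)}(x,y) = sup {h C : C ∈ T, x ∈ C, y ∈ C}`. -/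
noncomputable def mergeHeight {Ω : Type*} (T : Set (Set Ω)) (h : Set Ω → ℝ) (x y : Ω) :
    ℝ :=
  sSup {t | ∃ C ∈ T, x ∈ C ∧ y ∈ C ∧ t = h C}

/-- The merge distortion distance between two dendrograms:
`d_M = sup_{x,y} |m_{(T,h)}(x,y) − m_{(T',h')}(x,y)|` (valued in `[0,∞]`). -/
noncomputable def mergeDistortion {Ω : Type*} (T : Set (Set Ω)) (h : Set Ω → ℝ)
    (T' : Set (Set Ω)) (h' : Set Ω → ℝ) : ℝ≥0∞ :=
  ⨆ x : Ω, ⨆ y : Ω, edist (mergeHeight T h x y) (mergeHeight T' h' x y)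

/-- A cluster tree of the function `f`: a collection of connected subsets of `supp f`,
all with height `h_f(C) > 0`, any two of which are disjoint or nested. -/
def IsClusterTree {Ω : Type*} [TopologicalSpace Ω] (f : Ω → ℝ) (T : Set (Set Ω)) : Prop :=
  (∀ C ∈ T, C ⊆ closure (Function.support f) ∧ IsConnected C ∧ 0 < heightFn f C) ∧
  (∀ C ∈ T, ∀ C' ∈ T, Disjoint C C' ∨ C ⊆ C' ∨ C' ⊆ C)

/-- A cluster tree `T` is closed (for the height `h_f`) if for every nested
sub-collection `S ⊆ T`, the intersection `⋂₀ S` belongs to `T`, and the union `⋃₀ S`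
belongs to `T` whenever `inf_{C ∈ S} h_f(C) > 0`. -/
def IsClosedTree {Ω : Type*} [TopologicalSpace Ω] (f : Ω → ℝ) (T : Set (Set Ω)) : Prop :=
  ∀ S ⊆ T, S.Nonempty → IsChain (· ⊆ ·) S →
    ⋂₀ S ∈ T ∧ (0 < sInf (heightFn f '' S) → ⋃₀ S ∈ T)

/-- For a closed cluster tree, the supremum defining the merge height is attained:
for any `x, y` with `m_T(x, y) > 0` there is a cluster `C ∈ T` containing `x` and `y`
with `h_f(C) = m_T(x, y)`. -/
theorem closed_tree_merge_height_attained {Ω : Type*} [MetricSpace Ω]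
    [LocallyConnectedSpace Ω] (f : Ω → ℝ) (hf_nonneg : ∀ x, 0 ≤ f x)
    (T : Set (Set Ω)) (hT : IsClusterTree f T) (hclosed : IsClosedTree f T) :
    ∀ x y : Ω, 0 < mergeHeight T (heightFn f) x y →
      ∃ C ∈ T, x ∈ C ∧ y ∈ C ∧ heightFn f C = mergeHeight T (heightFn f) x y := by
  intro x y hpos
  have hgr : ∀ D ∈ T, x ∈ D → y ∈ D → (∀ C ∈ T, x ∈ C → y ∈ C → D ⊆ C) →
      heightFn f D = mergeHeight T (heightFn f) x y := by
    intro D hD hx hy hmin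
    symm
    apply IsGreatest.csSup_eq
    refine ⟨⟨D, hD, hx, hy, rfl⟩, ?_⟩
    rintro t ⟨C, hC, hxC, hyC, rfl⟩
    apply csInf_le_csInf
    · exact ⟨0, by rintro _ ⟨z, _, rfl⟩; exact hf_nonneg z⟩
    · exact ⟨f x, x, hx, rfl⟩
    · exact image_mono (hmin C hC hxC hyC)
  have hne : ({C | C ∈ T ∧ x ∈ C ∧ y ∈ C} : Set (Set Ω)).Nonempty := by
    by_contra hne
    have : {t | ∃ C ∈ T, x ∈ C ∧ y ∈ C ∧ t = heightFn f C} = ∅ := by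
      apply eq_empty_of_forall_notMem
      rintro t ⟨C, hC, hx, hy, _⟩
      exact hne ⟨C, hC, hx, hy⟩
    rw [mergeHeight, this, Real.sSup_empty] at hpos
    exact lt_irrefl _ hpos
  have hD := (hclosed {C | C ∈ T ∧ x ∈ C ∧ y ∈ C} (fun C h => h.1) hne (by
    rintro C ⟨hC, hx, hy⟩ C' ⟨hC', hx', hy'⟩ _
    rcases hT.2 C hC C' hC' with h | h
    · exact absurd hx' (disjoint_left.1 h hx)
    · exact h)).1
  have hx : x ∈ ⋂₀ {C | C ∈ T ∧ x ∈ C ∧ y ∈ C} := fun C h => h.2.1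
  have hy : y ∈ ⋂₀ {C | C ∈ T ∧ x ∈ C ∧ y ∈ C} := fun C h => h.2.2
  exact ⟨_, hD, hx, hy, hgr _ hD hx hy fun C hC h1 h2 => sInter_subset_of_mem ⟨hC, h1, h2⟩⟩
end

section
/- Let f : Ω → [0, ∞) be continuous and let 𝒞 be a closed cluster tree for f (all clusters having h_f > 0) such that d_M((𝒞, h_f), (H_f, h_f)) = 0. Then 𝒞 contains H_f: every connected component of every upper level set {f ≥ λ}, λ > 0, belongs to 𝒞. -/
open Set Topology ENNReal

/-- Let `f : Ω → [0,∞)` be continuous and `T` a closed cluster tree for `f` at merge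
distortion distance zero from the Hartigan tree.  Then `T` contains the Hartigan tree:
every connected component of every upper level set `{f ≥ lam}`, `lam > 0`, belongs to
`T`. -/
theorem closed_tree_merge_zero_contains_hartigan {Ω : Type*} [MetricSpace Ω]
    [LocallyConnectedSpace Ω] (f : Ω → ℝ) (hf_cont : Continuous f)
    (hf_nonneg : ∀ x, 0 ≤ f x) (T : Set (Set Ω))
    (hT : IsClusterTree f T) (hclosed : IsClosedTree f T)
    (hdM : mergeDistortion T (heightFn f) (HartiganTree f) (heightFn f) = 0) :
    HartiganTree f ⊆ T := by
  rintro H ⟨lam, hlam, x, hx, rfl⟩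
  have hbdd : ∀ C : Set Ω, BddBelow (f '' C) := fun C => ⟨0, by
    rintro _ ⟨z, _, rfl⟩; exact hf_nonneg z⟩
  have hle : ∀ (C : Set Ω) (z : Ω), z ∈ C → heightFn f C ≤ f z := fun C z hz =>
    csInf_le (hbdd C) ⟨z, hz, rfl⟩
  have hxH : x ∈ connectedComponentIn {y | lam ≤ f y} x := mem_connectedComponentIn hx
  have heq : ∀ y, mergeHeight T (heightFn f) x y
      = mergeHeight (HartiganTree f) (heightFn f) x y := by
    intro y
    have h1 : edist (mergeHeight T (heightFn f) x y)
        (mergeHeight (HartiganTree f) (heightFn f) x y) ≤ 0 := by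
      rw [← hdM]
      exact le_iSup₂ (f := fun x y => edist (mergeHeight T (heightFn f) x y)
        (mergeHeight (HartiganTree f) (heightFn f) x y)) x y
    exact edist_le_zero.1 h1
  have key : ∀ y ∈ connectedComponentIn {y | lam ≤ f y} x, ∀ d < lam,
      ∃ C ∈ T, x ∈ C ∧ y ∈ C ∧ d < heightFn f C := by
    intro y hy d hd
    have h1 : lam ≤ mergeHeight T (heightFn f) x y := by
      rw [heq]
      refine le_trans ?_ (le_csSup ⟨f x, ?_⟩
        ⟨_, ⟨lam, hlam, x, hx, rfl⟩, hxH, hy, rfl⟩)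
      · refine le_csInf ⟨_, x, hxH, rfl⟩ ?_
        rintro _ ⟨z, hz, rfl⟩
        exact connectedComponentIn_subset {y | lam ≤ f y} x hz
      · rintro _ ⟨C, _, hxC, _, rfl⟩
        exact hle C x hxC
    have hne : {t | ∃ C ∈ T, x ∈ C ∧ y ∈ C ∧ t = heightFn f C}.Nonempty := by
      by_contra hn
      rw [not_nonempty_iff_eq_empty] at hn
      rw [mergeHeight, hn, Real.sSup_empty] at h1
      linarith
    obtain ⟨t, ⟨C, hC, hxC, hyC, rfl⟩, ht⟩ := exists_lt_of_lt_csSup hne (hd.trans_le h1)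
    exact ⟨C, hC, hxC, hyC, ht⟩
  have hchain : ∀ S ⊆ T, (∀ C ∈ S, x ∈ C) → IsChain (· ⊆ ·) S := by
    intro S hS hxS A hA B hB _
    rcases hT.2 A (hS hA) B (hS hB) with h | h
    · exact absurd (hxS B hB) (disjoint_left.1 h (hxS A hA))
    · exact h
  let S : ℝ → Set (Set Ω) := fun d => {C | C ∈ T ∧ x ∈ C ∧ d < heightFn f C}
  have hSne : ∀ d < lam, (S d).Nonempty := fun d hd => by
    obtain ⟨C, hC, hxC, _, h⟩ := key x hxH d hd
    exact ⟨C, hC, hxC, h⟩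
  have hU : ∀ d, 0 < d → d < lam → ⋃₀ (S d) ∈ T := by
    intro d hd hdl
    refine (hclosed (S d) (fun C hC => hC.1) (hSne d hdl)
      (hchain _ (fun C hC => hC.1) (fun C hC => hC.2.1))).2 (hd.trans_le ?_)
    refine le_csInf ((hSne d hdl).image _) ?_
    rintro _ ⟨C, hC, rfl⟩
    exact hC.2.2.le
  let V : Set (Set Ω) := {U | ∃ d, 0 < d ∧ d < lam ∧ U = ⋃₀ (S d)}
  have hVT : V ⊆ T := by
    rintro _ ⟨d, h0, h1, rfl⟩; exact hU d h0 h1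
  have hHV : ∀ U ∈ V, connectedComponentIn {y | lam ≤ f y} x ⊆ U := by
    rintro _ ⟨d, h0, h1, rfl⟩ y hy
    obtain ⟨C, hC, hxC, hyC, h⟩ := key y hy d h1
    exact ⟨C, ⟨hC, hxC, h⟩, hyC⟩
  have hI : ⋂₀ V ∈ T := (hclosed V hVT ⟨_, lam / 2, by linarith, by linarith, rfl⟩
    (hchain V hVT (fun U hU => hHV U hU hxH))).1
  have : connectedComponentIn {y | lam ≤ f y} x = ⋂₀ V := by
    apply Subset.antisymm
    · exact subset_sInter hHV
    · refine (hT.1 _ hI).2.1.isPreconnected.subset_connectedComponentIn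
        (fun U hU => hHV U hU hxH) ?_
      intro y hy
      show lam ≤ f y
      refine le_of_forall_lt fun c hc => ?_
      have hm : max c (lam / 2) < lam := max_lt hc (by linarith)
      have h0 : 0 < max c (lam / 2) := lt_max_of_lt_right (by linarith)
      obtain ⟨C, hC, hyC⟩ := hy _ ⟨_, h0, hm, rfl⟩
      exact (le_max_left _ _).trans_lt (hC.2.2.trans_le (hle C y hyC))
  rw [this]
  exact hI
end

section
/- Let f : Ω → [0, ∞) be continuous, satisfying the splitting property, and let 𝒞 be a closed cluster tree for f (all clusters having h_f > 0) such that d_M((𝒞, h_f), (H_f, h_f)) = 0. Then for every C ∈ 𝒞 with λ = h_f(C), the set {x : f(x) > λ} ∩ C is a union of connected components of {x : f(x) > λ}; that is, every connected component R of {f > λ} with R ∩ C ≠ ∅ satisfies R ⊆ C. -/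
open Set Topology ENNReal

/-- `f` satisfies the splitting property: for every `lam > 0` and all small enough
`ε > 0`, each connected component of `{f > lam}` contains exactly one connected
component of `{f > lam + ε}`. -/
def SplittingProperty {Ω : Type*} [TopologicalSpace Ω] (f : Ω → ℝ) : Prop :=
  ∀ lam : ℝ, 0 < lam → ∃ ε₀ > (0 : ℝ), ∀ ε : ℝ, 0 < ε → ε ≤ ε₀ →
    ∀ R : Set Ω, IsConnCompOf {x | lam < f x} R →
      ∃! V : Set Ω, IsConnCompOf {x | lam + ε < f x} V ∧ V ⊆ R

/-- Let `f : Ω → [0,∞)` be continuous, satisfying the splitting property, and let `T` be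
a closed cluster tree for `f` at merge distortion distance zero from the Hartigan tree.
Then for every `C ∈ T` with `lam = h_f(C)`, the set `{f > lam} ∩ C` is a union of
connected components of `{f > lam}`: every connected component `R` of `{f > lam}`
meeting `C` satisfies `R ⊆ C`. -/
theorem closed_tree_merge_zero_component_structure {Ω : Type*} [MetricSpace Ω]
    [LocallyConnectedSpace Ω] (f : Ω → ℝ) (hf_cont : Continuous f)
    (hf_nonneg : ∀ x, 0 ≤ f x) (hsplit : SplittingProperty f) (T : Set (Set Ω))
    (hT : IsClusterTree f T) (hclosed : IsClosedTree f T)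
    (hdM : mergeDistortion T (heightFn f) (HartiganTree f) (heightFn f) = 0) :
    ∀ C ∈ T, ∀ R : Set Ω, IsConnCompOf {x | heightFn f C < f x} R →
      (R ∩ C).Nonempty → R ⊆ C := by
  intro C hC R hR ⟨x, hxR, hxC⟩ y hyR
  obtain ⟨z, hz, rfl⟩ := hR
  have hpos : 0 < heightFn f C := (hT.1 C hC).2.2
  obtain ⟨ε₀, hε₀, hs⟩ := hsplit _ hpos
  have hx : heightFn f C < f x := connectedComponentIn_subset {x | heightFn f C < f x} z hxR
  have hy : heightFn f C < f y := connectedComponentIn_subset {x | heightFn f C < f x} z hyR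
  have hbdd : ∀ D : Set Ω, BddBelow (f '' D) := fun D =>
    ⟨0, by rintro _ ⟨w, _, rfl⟩; exact hf_nonneg w⟩
  obtain ⟨ε, hε, hεle, hεx, hεy⟩ : ∃ ε : ℝ, 0 < ε ∧ ε ≤ ε₀ ∧
      heightFn f C + ε < f x ∧ heightFn f C + ε < f y := by
    have h1 : 0 < min ε₀ (min (f x - heightFn f C) (f y - heightFn f C)) :=
      lt_min hε₀ (lt_min (sub_pos.2 hx) (sub_pos.2 hy))
    have h2 := min_le_left ε₀ (min (f x - heightFn f C) (f y - heightFn f C))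
    have h3 := min_le_right ε₀ (min (f x - heightFn f C) (f y - heightFn f C))
    have h4 := le_min_iff.1 h3
    refine ⟨min ε₀ (min (f x - heightFn f C) (f y - heightFn f C)) / 2, ?_, ?_, ?_, ?_⟩ <;>
      linarith [h4.1, h4.2]
  have hsub : ∀ w, heightFn f C + ε < f w → w ∈ connectedComponentIn {x | heightFn f C < f x} z →
      connectedComponentIn {x | heightFn f C + ε < f x} w ⊆
        connectedComponentIn {x | heightFn f C < f x} z := by
    intro w hw hwz
    rw [connectedComponentIn_eq hwz]
    apply connectedComponentIn_mono
    intro u hu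
    simp only [mem_ofPred_eq] at hu ⊢
    linarith
  have huniq := (hs ε hε hεle _ ⟨z, hz, rfl⟩).unique
    ⟨⟨x, hεx, rfl⟩, hsub x hεx hxR⟩ ⟨⟨y, hεy, rfl⟩, hsub y hεy hyR⟩
  have hyV : y ∈ connectedComponentIn {x | heightFn f C + ε < f x} x := by
    rw [huniq]; exact mem_connectedComponentIn hεy
  have hxD : x ∈ connectedComponentIn {w | heightFn f C + ε ≤ f w} x :=
    mem_connectedComponentIn (le_of_lt hεx)
  have hyD : y ∈ connectedComponentIn {w | heightFn f C + ε ≤ f w} x :=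
    connectedComponentIn_mono x
      (show {w | heightFn f C + ε < f w} ⊆ {w | heightFn f C + ε ≤ f w} from
        fun u (hu : heightFn f C + ε < f u) => show heightFn f C + ε ≤ f u from le_of_lt hu) hyV
  have hH : heightFn f C + ε ≤ mergeHeight (HartiganTree f) (heightFn f) x y := by
    have h1 : heightFn f C + ε ≤ heightFn f (connectedComponentIn {w | heightFn f C + ε ≤ f w} x) := by
      apply le_csInf (Set.Nonempty.image f ⟨x, hxD⟩)
      rintro _ ⟨w, hw, rfl⟩
      exact connectedComponentIn_subset {w | heightFn f C + ε ≤ f w} x hw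
    refine h1.trans (le_csSup ⟨f x, ?_⟩
      ⟨_, ⟨heightFn f C + ε, by linarith, x, le_of_lt hεx, rfl⟩, hxD, hyD, rfl⟩)
    rintro _ ⟨D, _, hx', _, rfl⟩
    exact csInf_le (hbdd D) ⟨x, hx', rfl⟩
  have heq : mergeHeight T (heightFn f) x y = mergeHeight (HartiganTree f) (heightFn f) x y := by
    unfold mergeDistortion at hdM
    simp only [ENNReal.iSup_eq_zero] at hdM
    exact edist_eq_zero.1 (hdM x y)
  have hlt : heightFn f C < mergeHeight T (heightFn f) x y := by rw [heq]; linarith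
  have hne : {t | ∃ C ∈ T, x ∈ C ∧ y ∈ C ∧ t = heightFn f C}.Nonempty := by
    by_contra h
    rw [Set.not_nonempty_iff_eq_empty] at h
    unfold mergeHeight at hlt
    rw [h, Real.sSup_empty] at hlt
    linarith
  obtain ⟨_, ⟨D, hD, hxD', hyD', rfl⟩, hlt'⟩ := exists_lt_of_lt_csSup hne hlt
  rcases hT.2 C hC D hD with h | h | h
  · exact absurd hxD' (Set.disjoint_left.1 h hxC)
  · have : heightFn f D ≤ heightFn f C :=
      csInf_le_csInf (hbdd D) (Set.Nonempty.image f ⟨x, hxC⟩) (Set.image_mono h)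
    linarith
  · exact h hyD'
end
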